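/- Compositional Characterization Theorem: Let A, B be sets, R ⊆ A × B a relation, and P(B) a collection of non-empty predicates on B. Then R is belief-complete with respect to P(B) if and only if for every set C, every relation S ⊆ B × C, and every collection P(C) of non-empty predicates on C such that (1) S is assumption-complete with respect to P(C) and (2) ⊞_S p ∈ P(B) for every p ∈ P(C), the composition R ; S ⊆ A × C is assumption-complete with respect to P(C). -/

import Mathlib

universe u v w

/-- A relation `R : A → B → Prop` is assumption-complete with respect to a collection
`PB` of predicates on `B` if every `p ∈ PB` is assumed by some `x ∈ A`. -/
def AssumptionComplete {A : Type u} {B : Type v} (R : A → B → Prop)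
    (PB : Set (Set B)) : Prop :=
  ∀ p ∈ PB, ∃ x : A, ∀ y : B, R x y ↔ y ∈ p

/-- A relation `R : A → B → Prop` is belief-complete with respect to `PB` if for every
`p ∈ PB` there is `x ∈ A` which believes `p` (`R x y → y ∈ p`) and with `R x`
non-empty. -/
def BeliefComplete {A : Type u} {B : Type v} (R : A → B → Prop)
    (PB : Set (Set B)) : Prop :=
  ∀ p ∈ PB, ∃ x : A, (∀ y : B, R x y → y ∈ p) ∧ (∃ y : B, R x y)

/-- Compositional Characterization Theorem: `R : A → B → Prop` is belief-complete
w.r.t. a collection `PB` of non-empty predicates on `B` iff for every set `C`, every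
relation `S : B → C → Prop`, and every collection `PC` of non-empty predicates on `C`
such that `S` is assumption-complete w.r.t. `PC` and `⊞_S p ∈ PB` for every `p ∈ PC`,
the composition `R ; S` is assumption-complete w.r.t. `PC`. -/
theorem compositional_characterization {A : Type u} {B : Type v}
    (R : A → B → Prop) (PB : Set (Set B)) (hPB : ∀ p ∈ PB, p.Nonempty) :
    BeliefComplete R PB ↔
      ∀ (C : Type w) (S : B → C → Prop) (PC : Set (Set C)),
        (∀ p ∈ PC, p.Nonempty) →
        AssumptionComplete S PC →
        (∀ p ∈ PC, {y : B | ∀ z : C, S y z ↔ z ∈ p} ∈ PB) →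
        AssumptionComplete (fun (x : A) (z : C) => ∃ y : B, R x y ∧ S y z) PC := by
  constructor
  · intro hR C S PC _ _ hbox p hp
    obtain ⟨x, hx, y₀, hy₀⟩ := hR _ (hbox p hp)
    exact ⟨x, fun z => ⟨fun ⟨y, hxy, hyz⟩ => (hx y hxy z).1 hyz,
      fun hz => ⟨y₀, hy₀, (hx y₀ hy₀ z).2 hz⟩⟩⟩
  · intro h p hp
    -- Test against the characteristic relation of `p`, valued in a two-element type.
    let S : B → ULift.{w} Bool → Prop := fun y z => z.down = true ↔ y ∈ p
    have hS : {y : B | ∀ z, S y z ↔ z ∈ ({⟨true⟩} : Set (ULift.{w} Bool))} = p := by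
      ext y
      simp [S, ULift.forall, ULift.ext_iff]
    obtain ⟨x, hx⟩ := h (ULift.{w} Bool) S {{⟨true⟩}} (by simp)
      (by
        rintro q rfl
        obtain ⟨y, hy⟩ := hPB p hp
        rw [← hS] at hy
        exact ⟨y, hy⟩)
      (by
        rintro q rfl
        rwa [hS])
      _ rfl
    refine ⟨x, fun y hxy => ?_, ?_⟩
    · by_contra hy
      have := (hx ⟨false⟩).1 ⟨y, hxy, by simp [S, hy]⟩
      simp [ULift.ext_iff] at this
    · obtain ⟨y, hxy, _⟩ := (hx ⟨true⟩).2 rfl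
      exact ⟨y, hxy⟩
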